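/- arXiv:0907.2009 — 2 statements merged into one kernel-verified Lean document; each statement's English description precedes it below -/
import Mathlib

section
/- Let (X_t)_{t≥0} be an ergodic (irreducible, aperiodic, positive recurrent) stationary Markov chain on a countable state space with transition matrix P and stationary distribution π, and fix a state i with π_i > 0. Let T_{π,i} be distributed as inf{t ≥ 0 : X_t = i} when X_0 ~ π, and let T_{i,i} be distributed as inf{t > 0 : X_t = i} when X_0 = i, with T_{π,i} and T_{i,i} coupled arbitrarily on a common probability space. Then d_K(L(π_i T_{π,i}), Exp(1)) ≤ 1.5 π_i + π_i E|T_{π,i} − T_{i,i}|. -/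
open MeasureTheory ProbabilityTheory Set

noncomputable section

/-- The Kolmogorov distance between two measures on `ℝ`. -/
def dK (P Q : Measure ℝ) : ℝ :=
  ⨆ z : ℝ, |(P (Iic z)).toReal - (Q (Iic z)).toReal|

open Classical in
/-- `n`-step transition probabilities associated with a transition matrix `P`. -/
def matPow {S : Type*} (P : S → S → ℝ) : ℕ → S → S → ℝ
  | 0 => fun s t => if s = t then 1 else 0
  | (n + 1) => fun s t => ∑' u : S, matPow P n s u * P u t

/-- `X` is a (time homogeneous) Markov chain with transition matrix `P`:
all cylinder events based on singletons are measurable, and the conditional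
probability of `{X (n+1) = j}` given the past, on any cylinder event, is `P (X n) j`. -/
def IsMarkovChain {S Ω : Type*} [MeasurableSpace Ω] (μ : Measure Ω)
    (X : ℕ → Ω → S) (P : S → S → ℝ) : Prop :=
  (∀ n (j : S), MeasurableSet {ω | X n ω = j}) ∧
  ∀ (n : ℕ) (s : ℕ → S) (j : S),
    μ ({ω | ∀ k ≤ n, X k ω = s k} ∩ {ω | X (n + 1) ω = j})
      = ENNReal.ofReal (P (s n) j) * μ {ω | ∀ k ≤ n, X k ω = s k}

open Filter Topology
open scoped ENNReal

/-- The probability that a chain with transition matrix `P` started at `s` avoids `i` during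
its first `m` steps. -/
def avoidProb {S : Type*} (P : S → S → ℝ) (i : S) : ℕ → S → ℝ≥0∞
  | 0 => fun _ => 1
  | (m + 1) => fun s => ∑' t, ENNReal.ofReal (P s t) * indicator {i}ᶜ (avoidProb P i m) t

lemma measure_eq_tsum_inter_fiber {S Ω : Type*} [Countable S] [MeasurableSpace Ω] (μ : Measure Ω)
    {f : Ω → S} (hf : ∀ s, MeasurableSet {ω | f ω = s}) {E : Set Ω} (hE : MeasurableSet E) :
    μ E = ∑' s, μ (E ∩ {ω | f ω = s}) := by
  rw [← measure_iUnion _ fun s => hE.inter (hf s)]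
  · congr 1
    ext ω
    simp
  · intro s t hst
    refine Set.disjoint_left.2 fun ω hs ht => hst ?_
    exact hs.2.symm.trans ht.2

section MarkovChain

variable {S Ω : Type*} [MeasurableSpace Ω] {μ : Measure Ω} {X : ℕ → Ω → S} {P : S → S → ℝ}

lemma IsMarkovChain.measurableSet_avoid (hX : IsMarkovChain μ X P) (i : S) (n m : ℕ) :
    MeasurableSet {ω | ∀ k, n < k → k ≤ n + m → X k ω ≠ i} := by
  simp only [Set.ofPred_forall]
  exact .iInter fun k => .iInter fun _ => .iInter fun _ => (hX.1 k i).compl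

lemma IsMarkovChain.measurableSet_cylinder (hX : IsMarkovChain μ X P) (n : ℕ) (s : ℕ → S) :
    MeasurableSet {ω | ∀ k ≤ n, X k ω = s k} := by
  simp only [Set.ofPred_forall]
  exact .iInter fun k => .iInter fun _ => hX.1 k (s k)

lemma IsMarkovChain.measure_cylinder_inter_avoid [Countable S] (hX : IsMarkovChain μ X P) (i : S)
    (m n : ℕ) (s : ℕ → S) :
    μ ({ω | ∀ k ≤ n, X k ω = s k} ∩ {ω | ∀ k, n < k → k ≤ n + m → X k ω ≠ i})
      = μ {ω | ∀ k ≤ n, X k ω = s k} * avoidProb P i m (s n) := by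
  classical
  induction m generalizing n s with
  | zero =>
    have : {ω | ∀ k, n < k → k ≤ n + 0 → X k ω ≠ i} = univ := by
      ext ω
      simp only [mem_ofPred_eq, mem_univ, iff_true]
      omega
    rw [this, inter_univ, avoidProb, mul_one]
  | succ m ih =>
    rw [measure_eq_tsum_inter_fiber μ (hX.1 (n + 1))
      ((hX.measurableSet_cylinder n s).inter (hX.measurableSet_avoid i n (m + 1))),
      avoidProb, ← ENNReal.tsum_mul_left]
    refine tsum_congr fun t => ?_
    by_cases hti : t = i
    · subst hti
      have : {ω | ∀ k ≤ n, X k ω = s k} ∩ {ω | ∀ k, n < k → k ≤ n + (m + 1) → X k ω ≠ t}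
          ∩ {ω | X (n + 1) ω = t} = ∅ := by
        ext ω
        simp only [mem_inter_iff, mem_ofPred_eq, mem_empty_iff_false, iff_false, not_and]
        exact fun h => h.2 (n + 1) (by omega) (by omega)
      rw [this]
      simp
    · have hcyl : {ω | ∀ k ≤ n + 1, X k ω = Function.update s (n + 1) t k}
          = {ω | ∀ k ≤ n, X k ω = s k} ∩ {ω | X (n + 1) ω = t} := by
        ext ω
        simp only [mem_inter_iff, mem_ofPred_eq]
        refine ⟨fun h => ⟨fun k hk => ?_, by simpa using h (n + 1) le_rfl⟩, fun h k hk => ?_⟩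
        · simpa [Function.update_of_ne (show k ≠ n + 1 by omega)] using h k (by omega)
        · rcases eq_or_ne k (n + 1) with rfl | hk'
          · simpa using h.2
          · simpa [Function.update_of_ne hk'] using h.1 k (by omega)
      have hset : {ω | ∀ k ≤ n, X k ω = s k} ∩ {ω | ∀ k, n < k → k ≤ n + (m + 1) → X k ω ≠ i}
          ∩ {ω | X (n + 1) ω = t}
          = {ω | ∀ k ≤ n + 1, X k ω = Function.update s (n + 1) t k}
            ∩ {ω | ∀ k, n + 1 < k → k ≤ n + 1 + m → X k ω ≠ i} := by
        rw [hcyl]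
        ext ω
        simp only [mem_inter_iff, mem_ofPred_eq]
        refine ⟨fun h => ⟨⟨h.1.1, h.2⟩, fun k hk hk' => h.1.2 k (by omega) (by omega)⟩,
          fun h => ⟨⟨h.1.1, fun k hk hk' => ?_⟩, h.1.2⟩⟩
        rcases eq_or_ne k (n + 1) with rfl | hk''
        · rw [h.1.2]
          exact hti
        · exact h.2 k (by omega) (by omega)
      rw [hset, ih, hcyl, hX.2, Function.update_self,
        indicator_of_mem (by simpa using hti : t ∈ ({i} : Set S)ᶜ)]
      ring

lemma IsMarkovChain.measure_start_inter_avoid [Countable S] (hX : IsMarkovChain μ X P) (i : S)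
    (m : ℕ) (s : S) :
    μ ({ω | ∀ k, 0 < k → k ≤ m → X k ω ≠ i} ∩ {ω | X 0 ω = s})
      = μ {ω | X 0 ω = s} * avoidProb P i m s := by
  simpa [inter_comm] using hX.measure_cylinder_inter_avoid i m 0 fun _ => s

lemma tsum_mul_avoidProb_succ {π : S → ℝ} (hπnonneg : ∀ s, 0 ≤ π s) (hPnonneg : ∀ s t, 0 ≤ P s t)
    (hπstat : ∀ t, HasSum (fun s => π s * P s t) (π t)) (i : S) (m : ℕ) :
    ∑' s, ENNReal.ofReal (π s) * avoidProb P i (m + 1) s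
      = ∑' t, ENNReal.ofReal (π t) * indicator {i}ᶜ (avoidProb P i m) t := by
  simp only [avoidProb, ← ENNReal.tsum_mul_left]
  rw [ENNReal.tsum_comm]
  refine tsum_congr fun t => ?_
  rw [← (hπstat t).tsum_eq, ENNReal.ofReal_tsum_of_nonneg
    (fun s => mul_nonneg (hπnonneg s) (hPnonneg s t)) (hπstat t).summable, ← ENNReal.tsum_mul_right]
  refine tsum_congr fun s => ?_
  rw [ENNReal.ofReal_mul (hπnonneg s), mul_assoc]

lemma tsum_mul_avoidProb_eq_add {π : S → ℝ} (hπnonneg : ∀ s, 0 ≤ π s)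
    (hPnonneg : ∀ s t, 0 ≤ P s t) (hπstat : ∀ t, HasSum (fun s => π s * P s t) (π t)) (i : S)
    (m : ℕ) :
    ∑' s, ENNReal.ofReal (π s) * avoidProb P i m s
      = ∑' s, ENNReal.ofReal (π s) * avoidProb P i (m + 1) s
        + ENNReal.ofReal (π i) * avoidProb P i m i := by
  classical
  rw [tsum_mul_avoidProb_succ hπnonneg hPnonneg hπstat,
    ← tsum_ite_eq i (fun s => ENNReal.ofReal (π s) * avoidProb P i m s), ← ENNReal.tsum_add]
  refine tsum_congr fun s => ?_
  by_cases h : s = i <;> simp [h]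

lemma tendsto_avoidProb_self {π : S → ℝ} (hπnonneg : ∀ s, 0 ≤ π s)
    (hπsum : HasSum π 1) (hPnonneg : ∀ s t, 0 ≤ P s t)
    (hπstat : ∀ t, HasSum (fun s => π s * P s t) (π t)) {i : S} (hπi : 0 < π i) :
    Tendsto (fun m => avoidProb P i m i) atTop (𝓝 0) := by
  have hsum (n : ℕ) : ∑ m ∈ Finset.range n, ENNReal.ofReal (π i) * avoidProb P i m i
      + ∑' s, ENNReal.ofReal (π s) * avoidProb P i n s = 1 := by
    induction n with
    | zero =>
      simp [avoidProb, ← ENNReal.ofReal_tsum_of_nonneg hπnonneg hπsum.summable, hπsum.tsum_eq]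
    | succ n ih =>
      rw [← ih, Finset.sum_range_succ, tsum_mul_avoidProb_eq_add hπnonneg hPnonneg hπstat i n]
      ring
  have hle : ENNReal.ofReal (π i) * ∑' m, avoidProb P i m i ≤ 1 := by
    rw [← ENNReal.tsum_mul_left, ENNReal.tsum_eq_iSup_nat]
    exact iSup_le fun n => le_self_add.trans (hsum n).le
  refine ENNReal.tendsto_atTop_zero_of_tsum_ne_top fun htop => ?_
  rw [htop, ENNReal.mul_top (by simpa using hπi)] at hle
  simp at hle

lemma tendsto_avoidProb_of_step (hPnonneg : ∀ s t, 0 ≤ P s t) {i u s : S} (hP : P u s ≠ 0)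
    (hi : Tendsto (fun m => avoidProb P i m i) atTop (𝓝 0))
    (hu : Tendsto (fun m => avoidProb P i m u) atTop (𝓝 0)) :
    Tendsto (fun m => avoidProb P i m s) atTop (𝓝 0) := by
  rcases eq_or_ne s i with rfl | hs
  · exact hi
  have hPpos : ENNReal.ofReal (P u s) ≠ 0 := by
    simpa using (hPnonneg u s).lt_of_ne' hP
  have hlim := ENNReal.Tendsto.const_mul (a := (ENNReal.ofReal (P u s))⁻¹)
    ((tendsto_add_atTop_iff_nat 1).2 hu) (.inr (ENNReal.inv_ne_top.2 hPpos))
  rw [mul_zero] at hlim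
  refine tendsto_of_tendsto_of_tendsto_of_le_of_le tendsto_const_nhds hlim (fun _ => zero_le)
    fun m => ?_
  have hle : ENNReal.ofReal (P u s) * avoidProb P i m s ≤ avoidProb P i (m + 1) u := by
    refine le_trans ?_ (ENNReal.le_tsum s)
    rw [indicator_of_mem (by simpa using hs : s ∈ ({i} : Set S)ᶜ)]
  calc avoidProb P i m s
      = (ENNReal.ofReal (P u s))⁻¹ * (ENNReal.ofReal (P u s) * avoidProb P i m s) := by
        rw [← mul_assoc, ENNReal.inv_mul_cancel hPpos ENNReal.ofReal_ne_top, one_mul]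
    _ ≤ _ := by gcongr

lemma tendsto_avoidProb_of_matPow_ne_zero (hPnonneg : ∀ s t, 0 ≤ P s t) {i : S}
    (hi : Tendsto (fun m => avoidProb P i m i) atTop (𝓝 0)) (n : ℕ) (s : S)
    (hs : matPow P n i s ≠ 0) : Tendsto (fun m => avoidProb P i m s) atTop (𝓝 0) := by
  induction n generalizing s with
  | zero =>
    have : i = s := by
      by_contra h
      simp [matPow, h] at hs
    exact this ▸ hi
  | succ n ih =>
    have : ∃ u, matPow P n i u * P u s ≠ 0 := by
      by_contra! h
      simp [matPow, h] at hs
    obtain ⟨u, hu⟩ := this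
    exact tendsto_avoidProb_of_step hPnonneg (right_ne_zero_of_mul hu) hi
      (ih u (left_ne_zero_of_mul hu))

lemma IsMarkovChain.ae_exists_pos_eq [Countable S] [IsFiniteMeasure μ]
    (hX : IsMarkovChain μ X P) {i : S}
    (h : ∀ s, μ {ω | X 0 ω = s} ≠ 0 → Tendsto (fun m => avoidProb P i m s) atTop (𝓝 0)) :
    ∀ᵐ ω ∂μ, ∃ t, 0 < t ∧ X t ω = i := by
  have hnull (s : S) : μ ({ω | ∀ t, 0 < t → X t ω ≠ i} ∩ {ω | X 0 ω = s}) = 0 := by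
    by_cases hs : μ {ω | X 0 ω = s} = 0
    · exact measure_mono_null inter_subset_right hs
    have hlim := ENNReal.Tendsto.const_mul (a := μ {ω | X 0 ω = s}) (h s hs)
      (.inr (measure_ne_top μ _))
    rw [mul_zero] at hlim
    refine le_antisymm (ge_of_tendsto' hlim fun m => ?_) zero_le
    rw [← hX.measure_start_inter_avoid i m s]
    exact measure_mono (inter_subset_inter_left _ fun ω hω k hk _ => hω k hk)
  have hunion := measure_iUnion_null hnull
  rw [ae_iff]
  refine measure_mono_null (fun ω hω => ?_) hunion
  simpa using hω

lemma IsMarkovChain.measure_avoid_of_ae_start [Countable S] [IsProbabilityMeasure μ]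
    (hX : IsMarkovChain μ X P) {i : S} (h0 : ∀ᵐ ω ∂μ, X 0 ω = i) (m : ℕ) :
    μ {ω | ∀ k, 0 < k → k ≤ m → X k ω ≠ i} = avoidProb P i m i := by
  have h1 : μ {ω | X 0 ω = i} = 1 := (mem_ae_iff_prob_eq_one (hX.1 0 i)).1 h0
  rw [← one_mul (avoidProb P i m i), ← h1, ← hX.measure_start_inter_avoid i m i]
  refine measure_congr ?_
  filter_upwards [h0] with ω hω
  refine propext ?_
  exact ⟨fun h => ⟨h, hω⟩, fun h => h.1⟩

lemma IsMarkovChain.measure_avoid_of_stationary [Countable S] [IsProbabilityMeasure μ]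
    (hX : IsMarkovChain μ X P) {π : S → ℝ} (hπnonneg : ∀ s, 0 ≤ π s) (hπsum : HasSum π 1)
    (hPnonneg : ∀ s t, 0 ≤ P s t) (hπstat : ∀ t, HasSum (fun s => π s * P s t) (π t))
    (h0 : ∀ s, μ {ω | X 0 ω = s} = ENNReal.ofReal (π s)) (i : S) (m : ℕ) :
    μ {ω | ∀ k < m, X k ω ≠ i} = ∑' s, ENNReal.ofReal (π s) * avoidProb P i m s := by
  cases m with
  | zero => simp [avoidProb, ← ENNReal.ofReal_tsum_of_nonneg hπnonneg hπsum.summable, hπsum.tsum_eq]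
  | succ m =>
    have hE : MeasurableSet {ω | ∀ k < m + 1, X k ω ≠ i} := by
      simp only [Set.ofPred_forall]
      exact .iInter fun k => .iInter fun _ => (hX.1 k i).compl
    rw [tsum_mul_avoidProb_succ hπnonneg hPnonneg hπstat,
      measure_eq_tsum_inter_fiber μ (hX.1 0) hE]
    refine tsum_congr fun s => ?_
    rcases eq_or_ne s i with rfl | hs
    · have : {ω | ∀ k < m + 1, X k ω ≠ s} ∩ {ω | X 0 ω = s} = ∅ := by
        ext ω
        simp only [mem_inter_iff, mem_ofPred_eq, mem_empty_iff_false, iff_false, not_and]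
        exact fun h => h 0 (by omega)
      rw [this]
      simp
    · rw [indicator_of_mem (by simpa using hs : s ∈ ({i} : Set S)ᶜ), ← h0,
        ← hX.measure_start_inter_avoid]
      congr 1
      ext ω
      simp only [mem_inter_iff, mem_ofPred_eq]
      refine ⟨fun h => ⟨fun k _ hk => h.1 k (by omega), h.2⟩, fun h => ⟨fun k hk => ?_, h.2⟩⟩
      rcases k.eq_zero_or_pos with rfl | hk'
      · rw [h.2]
        exact hs
      · exact h.1 k hk' (by omega)

end MarkovChain

lemma Nat.le_sInf_iff_of_nonempty {s : Set ℕ} (hs : s.Nonempty) {k : ℕ} :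
    k ≤ sInf s ↔ ∀ j < k, j ∉ s :=
  ⟨fun h _ hj => Nat.notMem_of_lt_sInf (hj.trans_le h),
    fun h => not_lt.1 fun hlt => h _ hlt (Nat.sInf_mem hs)⟩

lemma measurable_sInf_setOf {Ω : Type*} [MeasurableSpace Ω] {p : ℕ → Ω → Prop}
    (hp : ∀ t, MeasurableSet {ω | p t ω}) : Measurable fun ω => sInf {t | p t ω} := by
  refine measurable_of_Ici fun k => ?_
  have hset : (fun ω => sInf {t | p t ω}) ⁻¹' Ici k
      = (if k = 0 then univ else {ω | ∃ t, p t ω}) ∩ {ω | ∀ j < k, ¬ p j ω} := by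
    ext ω
    by_cases hω : ∃ t, p t ω
    · have := Nat.le_sInf_iff_of_nonempty (s := {t | p t ω}) hω (k := k)
      by_cases hk : k = 0
      · simp [hk]
      · simpa [hk, hω] using this
    · have hempty : {t | p t ω} = ∅ := by
        ext t
        simpa using not_exists.1 hω t
      by_cases hk : k = 0
      · simp [hk]
      · simp [hk, hω, hempty]
  rw [hset]
  refine MeasurableSet.inter ?_ ?_
  · split_ifs
    · exact .univ
    · simp only [Set.ofPred_exists]
      exact .iUnion hp
  · simp only [Set.ofPred_forall]
    exact .iInter fun j => .iInter fun _ => (hp j).compl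

lemma sum_abs_indicator_lt_sub_le (a b n : ℕ) :
    ∑ k ∈ Finset.range n, |(if k < a then (1 : ℝ) else 0) - (if k < b then 1 else 0)|
      ≤ |(a : ℝ) - b| := by
  wlog hab : a ≤ b generalizing a b
  · simpa only [abs_sub_comm] using this b a (by omega)
  have hterm (k : ℕ) : |(if k < a then (1 : ℝ) else 0) - (if k < b then 1 else 0)|
      = if k ∈ Finset.Ico a b then 1 else 0 := by
    simp only [Finset.mem_Ico]
    split_ifs <;> first | omega | simp
  simp only [hterm, Finset.sum_ite_mem, Finset.sum_const, nsmul_eq_mul, mul_one]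
  rw [abs_sub_comm, abs_of_nonneg (by simpa using hab), ← Nat.cast_sub hab]
  exact_mod_cast (Finset.card_le_card Finset.inter_subset_right).trans (Nat.card_Ico a b).le

lemma sum_abs_measureReal_lt_sub_le {Ω : Type*} [MeasurableSpace Ω] {μ : Measure Ω}
    [IsProbabilityMeasure μ] {T T' : Ω → ℕ} (hT : Measurable T) (hT' : Measurable T')
    (hint : Integrable (fun ω => (T ω : ℝ) - (T' ω : ℝ)) μ) (n : ℕ) :
    ∑ k ∈ Finset.range n, |μ.real {ω | k < T ω} - μ.real {ω | k < T' ω}|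
      ≤ ∫ ω, |(T ω : ℝ) - (T' ω : ℝ)| ∂μ := by
  have hind {U : Ω → ℕ} (hU : Measurable U) (k : ℕ) :
      Integrable (fun ω => if k < U ω then (1 : ℝ) else 0) μ ∧
        ∫ ω, (if k < U ω then (1 : ℝ) else 0) ∂μ = μ.real {ω | k < U ω} := by
    have hm : MeasurableSet {ω | k < U ω} := hU measurableSet_Ioi
    have heq : (fun ω => if k < U ω then (1 : ℝ) else 0) = indicator {ω | k < U ω} 1 := by
      ext ω
      simp [indicator_apply]
    rw [heq]
    exact ⟨(integrable_const (1 : ℝ)).indicator hm, integral_indicator_one hm⟩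
  have hdiff (k : ℕ) : Integrable
      (fun ω => (if k < T ω then (1 : ℝ) else 0) - (if k < T' ω then 1 else 0)) μ :=
    (hind hT k).1.sub (hind hT' k).1
  calc ∑ k ∈ Finset.range n, |μ.real {ω | k < T ω} - μ.real {ω | k < T' ω}|
      ≤ ∑ k ∈ Finset.range n,
        ∫ ω, |(if k < T ω then (1 : ℝ) else 0) - (if k < T' ω then 1 else 0)| ∂μ := by
        refine Finset.sum_le_sum fun k _ => ?_
        rw [← (hind hT k).2, ← (hind hT' k).2, ← integral_sub (hind hT k).1 (hind hT' k).1]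
        exact abs_integral_le_integral_abs
    _ = ∫ ω, ∑ k ∈ Finset.range n,
        |(if k < T ω then (1 : ℝ) else 0) - (if k < T' ω then 1 else 0)| ∂μ :=
        (integral_finsetSum _ fun k _ => (hdiff k).abs).symm
    _ ≤ _ := integral_mono (integrable_finsetSum _ fun k _ => (hdiff k).abs) hint.abs
        fun ω => sum_abs_indicator_lt_sub_le (T ω) (T' ω) n

/-- A geometric approximation of the solution of a perturbed linear recursion. -/
lemma abs_sub_inv_pow_le_of_recursion {p : ℝ} (hp : 0 < p) {a b : ℕ → ℝ} (ha : a 0 = 1)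
    (hab : ∀ k, a k = a (k + 1) + p * b k) (n : ℕ) :
    |a n - ((1 + p)⁻¹) ^ n| ≤ p * ∑ k ∈ Finset.range n, |a (k + 1) - b k| := by
  induction n with
  | zero => simp [ha]
  | succ n ih =>
    have hr : (1 + p)⁻¹ ≤ 1 := inv_le_one_of_one_le₀ (by linarith)
    have hr0 : 0 ≤ (1 + p)⁻¹ := by positivity
    have hstep : a (n + 1) - ((1 + p)⁻¹) ^ (n + 1)
        = (1 + p)⁻¹ * ((a n - ((1 + p)⁻¹) ^ n) + p * (a (n + 1) - b n)) := by
      rw [hab n, pow_succ]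
      field_simp
      ring
    rw [hstep, abs_mul, abs_of_nonneg hr0, Finset.sum_range_succ, mul_add]
    calc _ ≤ 1 * |(a n - ((1 + p)⁻¹) ^ n) + p * (a (n + 1) - b n)| := by gcongr
      _ ≤ |a n - ((1 + p)⁻¹) ^ n| + |p * (a (n + 1) - b n)| := by
        rw [one_mul]
        exact abs_add_le _ _
      _ ≤ _ := by
        rw [abs_mul, abs_of_pos hp]
        gcongr

lemma abs_inv_pow_sub_exp_neg_le {p z : ℝ} (hp : 0 < p) {n : ℕ} (hz : p * n ≤ z)
    (hz' : z ≤ p * (n + 1)) : |((1 + p)⁻¹) ^ (n + 1) - Real.exp (-z)| ≤ p := by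
  set l := Real.log (1 + p) with hl
  have hlp : l ≤ p := by
    have := Real.log_le_sub_one_of_pos (show 0 < 1 + p by linarith)
    linarith
  have hpl : p / (1 + p) ≤ l := by
    have := Real.one_sub_inv_le_log_of_pos (show 0 < 1 + p by linarith)
    convert this using 1
    field_simp
    ring
  have hl0 : 0 < l := lt_of_lt_of_le (by positivity) hpl
  have hpl' : p - l ≤ p * l := by
    rw [div_le_iff₀ (by linarith)] at hpl
    linarith
  have hpow : ((1 + p)⁻¹) ^ (n + 1) = Real.exp (-(l * (n + 1))) := by
    rw [Real.exp_neg, mul_comm, ← Nat.cast_add_one,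
      Real.exp_nat_mul, hl, Real.exp_log (by linarith), inv_pow]
  have hn : (0 : ℝ) ≤ n := n.cast_nonneg
  have hz0 : 0 ≤ z := le_trans (by positivity) hz
  rw [hpow, abs_le]
  constructor
  · have h1 : Real.exp (-z) - Real.exp (-(l * (n + 1))) ≤ p := by
      have h2 := Real.add_one_le_exp (z - l * (n + 1))
      have h3 : Real.exp (-z) * Real.exp (z - l * (n + 1)) = Real.exp (-(l * (n + 1))) := by
        rw [← Real.exp_add]
        ring_nf
      have h4 : Real.exp (-z) ≤ 1 := Real.exp_le_one_iff.2 (by linarith)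
      have h5 : l * (n + 1) - z ≤ p := by nlinarith
      have h6 := Real.exp_pos (-z)
      nlinarith
    linarith
  · have h2 := Real.add_one_le_exp (l * (n + 1) - z)
    have h3 : Real.exp (-(l * (n + 1))) * Real.exp (l * (n + 1) - z) = Real.exp (-z) := by
      rw [← Real.exp_add]
      ring_nf
    have h4 : Real.exp (-(l * (n + 1))) * (l * (n + 1)) ≤ 1 := by
      have h5 := Real.add_one_le_exp (l * (n + 1))
      have h6 : Real.exp (-(l * (n + 1))) * Real.exp (l * (n + 1)) = 1 := by
        rw [← Real.exp_add]
        simp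
      have h7 := Real.exp_pos (-(l * (n + 1)))
      nlinarith
    have h5 : z - l * (n + 1) ≤ p * (l * (n + 1)) := by nlinarith
    have h6 := Real.exp_pos (-(l * (n + 1)))
    nlinarith

lemma expMeasure_one_Iic_toReal (z : ℝ) :
    (expMeasure 1 (Iic z)).toReal = if 0 ≤ z then 1 - Real.exp (-z) else 0 := by
  have := isProbabilityMeasure_expMeasure one_pos
  have h := cdf_expMeasure_eq one_pos z
  rw [cdf_eq_real, measureReal_def, one_mul] at h
  exact h

/-- Kolmogorov distance of a scaled `ℕ`-valued variable to the exponential distribution,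
from a geometric approximation of its tails. -/
lemma dK_map_mul_le {Ω : Type*} [MeasurableSpace Ω] {μ : Measure Ω} [IsProbabilityMeasure μ]
    {T : Ω → ℕ} (hT : Measurable T) {p c : ℝ} (hp : 0 < p)
    (h : ∀ n, |μ.real {ω | n ≤ T ω} - ((1 + p)⁻¹) ^ n| ≤ c) :
    dK (Measure.map (fun ω => p * (T ω : ℝ)) μ) (expMeasure 1) ≤ p + c := by
  have hc : 0 ≤ c := (abs_nonneg _).trans (h 0)
  have hmeas : Measurable fun ω => p * (T ω : ℝ) :=
    (measurable_from_top.comp hT).const_mul p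
  refine ciSup_le fun z => ?_
  rw [Measure.map_apply hmeas measurableSet_Iic, expMeasure_one_Iic_toReal]
  split_ifs with hz
  · set n := ⌊z / p⌋₊ with hn
    have hset : (fun ω => p * (T ω : ℝ)) ⁻¹' Iic z = {ω | n + 1 ≤ T ω}ᶜ := by
      ext ω
      simp only [mem_preimage, mem_Iic, mem_compl_iff, mem_ofPred_eq, not_le, Nat.lt_succ_iff, hn]
      rw [Nat.le_floor_iff (by positivity), le_div_iff₀ hp, mul_comm]
    have hmeas' : MeasurableSet {ω | n + 1 ≤ T ω} := hT measurableSet_Ici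
    rw [hset, ← measureReal_def, probReal_compl_eq_one_sub hmeas']
    have h1 := h (n + 1)
    have hfl := Nat.floor_le (show 0 ≤ z / p by positivity)
    have hfl' := Nat.lt_floor_add_one (z / p)
    rw [le_div_iff₀ hp] at hfl
    rw [div_lt_iff₀ hp] at hfl'
    have h2 := abs_inv_pow_sub_exp_neg_le hp (n := n) (z := z) (by linarith) (by linarith)
    rw [abs_le] at h1 h2 ⊢
    constructor <;> linarith
  · have hset : (fun ω => p * (T ω : ℝ)) ⁻¹' Iic z = ∅ := by
      ext ω
      simp only [mem_preimage, mem_Iic, mem_empty_iff_false, iff_false, not_le]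
      exact (not_le.1 hz).trans_le (by positivity)
    rw [hset]
    simp only [measure_empty, ENNReal.toReal_zero, sub_self, abs_zero]
    positivity

theorem kolmogorov_bound_hitting_time_coupling
    {S : Type*} [Countable S]
    {Ω : Type*} [MeasurableSpace Ω] (μ : Measure Ω) [IsProbabilityMeasure μ]
    (P : S → S → ℝ) (π : S → ℝ) (i : S)
    -- `P` is a stochastic matrix:
    (hPnonneg : ∀ s t, 0 ≤ P s t) (hProw : ∀ s, HasSum (P s) 1)
    -- `π` is a stationary probability distribution (this, together with
    -- irreducibility, expresses positive recurrence):
    (hπnonneg : ∀ s, 0 ≤ π s) (hπsum : HasSum π 1)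
    (hπstat : ∀ t, HasSum (fun s => π s * P s t) (π t))
    (hπi : 0 < π i)
    -- the chain is irreducible and aperiodic:
    (hirr : ∀ s t : S, ∃ n : ℕ, 0 < n ∧ 0 < matPow P n s t)
    (haper : ∀ s : S, ∃ N₀ : ℕ, ∀ n ≥ N₀, 0 < matPow P n s s)
    -- `X` is a stationary Markov chain with transition matrix `P`:
    (X : ℕ → Ω → S) (hX : IsMarkovChain μ X P)
    (hXstat : ∀ (t : ℕ) (j : S), μ {ω | X t ω = j} = ENNReal.ofReal (π j))
    -- `Y` is a Markov chain with transition matrix `P` started at `i`: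
    (Y : ℕ → Ω → S) (hY : IsMarkovChain μ Y P) (hY0 : ∀ᵐ ω ∂μ, Y 0 ω = i)
    -- the hitting times:
    (Tπ Tii : Ω → ℕ)
    (hTπ : ∀ ω, Tπ ω = sInf {t : ℕ | X t ω = i})
    (hTii : ∀ ω, Tii ω = sInf {t : ℕ | 0 < t ∧ Y t ω = i}) :
    ENNReal.ofReal (dK (Measure.map (fun ω => π i * (Tπ ω : ℝ)) μ) (expMeasure 1))
      ≤ ENNReal.ofReal (1.5 * π i)
        + ENNReal.ofReal (π i) * ∫⁻ ω, ENNReal.ofReal |(Tπ ω : ℝ) - (Tii ω : ℝ)| ∂μ := by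
  have hlim_i := tendsto_avoidProb_self hπnonneg hπsum hPnonneg hπstat hπi
  have hlim (s : S) : Tendsto (fun m => avoidProb P i m s) atTop (𝓝 0) := by
    obtain ⟨n, -, hn⟩ := hirr i s
    exact tendsto_avoidProb_of_matPow_ne_zero hPnonneg hlim_i n s hn.ne'
  have hTπ_meas : Measurable Tπ := by
    rw [funext hTπ]
    exact measurable_sInf_setOf fun t => hX.1 t i
  have hTii_meas : Measurable Tii := by
    rw [funext hTii]
    refine measurable_sInf_setOf (p := fun t ω => 0 < t ∧ Y t ω = i) fun t => ?_
    exact (MeasurableSet.const (0 < t)).inter (hY.1 t i)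
  have htail_π (k : ℕ) :
      μ {ω | k ≤ Tπ ω} = ∑' s, ENNReal.ofReal (π s) * avoidProb P i k s := by
    rw [← hX.measure_avoid_of_stationary hπnonneg hπsum hPnonneg hπstat (hXstat 0)]
    refine measure_congr ?_
    filter_upwards [hX.ae_exists_pos_eq fun s _ => hlim s] with ω hω
    obtain ⟨t, -, ht⟩ := hω
    refine propext ?_
    change k ≤ Tπ ω ↔ ∀ j < k, X j ω ≠ i
    rw [hTπ, Nat.le_sInf_iff_of_nonempty ⟨t, ht⟩]
    rfl
  have htail_ii (k : ℕ) : μ {ω | k < Tii ω} = avoidProb P i k i := by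
    rw [← hY.measure_avoid_of_ae_start hY0]
    refine measure_congr ?_
    filter_upwards [hY.ae_exists_pos_eq fun s _ => hlim s] with ω hω
    obtain ⟨t, ht0, ht⟩ := hω
    refine propext ?_
    change k < Tii ω ↔ ∀ j, 0 < j → j ≤ k → Y j ω ≠ i
    rw [hTii, ← Nat.succ_le_iff,
      Nat.le_sInf_iff_of_nonempty (s := {t | 0 < t ∧ Y t ω = i}) ⟨t, ht0, ht⟩]
    simp only [mem_ofPred_eq, not_and, Nat.succ_eq_add_one, Nat.lt_succ_iff]
    exact ⟨fun h j h0 hj => h j hj h0, fun h j hj h0 => h j h0 hj⟩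
  have hrec (k : ℕ) :
      μ.real {ω | k ≤ Tπ ω} = μ.real {ω | k + 1 ≤ Tπ ω} + π i * μ.real {ω | k < Tii ω} := by
    have h : μ {ω | k ≤ Tπ ω}
        = μ {ω | k + 1 ≤ Tπ ω} + ENNReal.ofReal (π i) * μ {ω | k < Tii ω} := by
      rw [htail_π, htail_π, htail_ii]
      exact tsum_mul_avoidProb_eq_add hπnonneg hPnonneg hπstat i k
    rw [measureReal_def, h, ENNReal.toReal_add (measure_ne_top μ _)
      (ENNReal.mul_ne_top ENNReal.ofReal_ne_top (measure_ne_top μ _)), ENNReal.toReal_mul,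
      ENNReal.toReal_ofReal (hπnonneg i)]
    rfl
  by_cases htop : ∫⁻ ω, ENNReal.ofReal |(Tπ ω : ℝ) - (Tii ω : ℝ)| ∂μ = ⊤
  · rw [htop, ENNReal.mul_top (by simpa using hπi), add_top]
    exact le_top
  have hmeas : Measurable fun ω => (Tπ ω : ℝ) - (Tii ω : ℝ) :=
    (measurable_from_top.comp hTπ_meas).sub (measurable_from_top.comp hTii_meas)
  have hint : Integrable (fun ω => (Tπ ω : ℝ) - (Tii ω : ℝ)) μ := by
    refine ⟨hmeas.aestronglyMeasurable, ?_⟩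
    rw [hasFiniteIntegral_iff_norm]
    exact lt_top_iff_ne_top.2 htop
  have hD : ∫⁻ ω, ENNReal.ofReal |(Tπ ω : ℝ) - (Tii ω : ℝ)| ∂μ
      = ENNReal.ofReal (∫ ω, |(Tπ ω : ℝ) - (Tii ω : ℝ)| ∂μ) :=
    (ofReal_integral_eq_lintegral_ofReal hint.abs (ae_of_all _ fun _ => abs_nonneg _)).symm
  have hD0 : 0 ≤ ∫ ω, |(Tπ ω : ℝ) - (Tii ω : ℝ)| ∂μ := integral_nonneg fun _ => abs_nonneg _
  rw [hD, ← ENNReal.ofReal_mul hπi.le, ← ENNReal.ofReal_add (by positivity) (by positivity)]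
  refine ENNReal.ofReal_le_ofReal ?_
  have hbound := dK_map_mul_le hTπ_meas hπi fun n =>
    (abs_sub_inv_pow_le_of_recursion hπi (a := fun k => μ.real {ω | k ≤ Tπ ω})
      (b := fun k => μ.real {ω | k < Tii ω}) (by simp) hrec n).trans
    (mul_le_mul_of_nonneg_left (sum_abs_measureReal_lt_sub_le hTπ_meas hTii_meas hint n) hπi.le)
  linarith

end
end

section
/- Let W be a non-negative random variable with E W = 1 and E W² < ∞ that is either NBUE or NWUE, let W^e have the equilibrium distribution with respect to W, and set ρ = |½ E W² − 1|. Then d_W(L(W), Exp(1)) ≤ 2ρ, d_K(L(W), Exp(1)) ≤ 2.47 ρ^{1/2}, d_W(L(W^e), Exp(1)) ≤ ρ, and d_K(L(W^e), Exp(1)) ≤ ρ. -/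
open MeasureTheory ProbabilityTheory Set

noncomputable section

/-- The Wasserstein distance between two measures on `ℝ`: the supremum of
`|∫ h dP - ∫ h dQ|` over all `1`-Lipschitz functions `h : ℝ → ℝ`. -/
def dW (P Q : Measure ℝ) : ℝ :=
  ⨆ h : {h : ℝ → ℝ // LipschitzWith 1 h}, |∫ x, h.1 x ∂P - ∫ x, h.1 x ∂Q|

/-- `We` has the equilibrium distribution with respect to `W`: its law has density
`P[W > x] / E W` on `[0,∞)` with respect to Lebesgue measure. -/
def IsEquilibrium {Ω : Type*} [MeasurableSpace Ω] (μ : Measure Ω) (W We : Ω → ℝ) : Prop :=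
  Measure.map We μ =
    volume.withDensity (fun x =>
      if 0 ≤ x then μ {ω | x < W ω} / ENNReal.ofReal (∫ ω, W ω ∂μ) else 0)

/-- `X` is NBUE (new better than used in expectation): `E[X - s | X > s] ≤ E X`
for all `s > 0`. -/
def NBUE {Ω : Type*} [MeasurableSpace Ω] (μ : Measure Ω) (X : Ω → ℝ) : Prop :=
  ∀ s : ℝ, 0 < s → μ {ω | s < X ω} ≠ 0 →
    ∫ ω, (X ω - s) ∂(μ[|{ω | s < X ω}]) ≤ ∫ ω, X ω ∂μ

/-- `X` is NWUE (new worse than used in expectation): `E[X - s | X > s] ≥ E X`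
for all `s > 0`. -/
def NWUE {Ω : Type*} [MeasurableSpace Ω] (μ : Measure Ω) (X : Ω → ℝ) : Prop :=
  ∀ s : ℝ, 0 < s → μ {ω | s < X ω} ≠ 0 →
    ∫ ω, X ω ∂μ ≤ ∫ ω, (X ω - s) ∂(μ[|{ω | s < X ω}])

/-- Tail integration formula: integrating the primitive of `g` against a finite measure `P` amounts
to integrating `g` against the tail of `P`. -/
theorem integral_primitive_eq_integral_tail (P : Measure ℝ) [IsFiniteMeasure P] {g : ℝ → ℝ}
    (hg : Measurable g) (hint : ∀ x, IntegrableOn g (Ioo 0 x))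
    (hP : Integrable (fun x => ∫ t in Ioo 0 x, |g t|) P) :
    IntegrableOn (fun t => g t * P.real (Ioi t)) (Ioi 0) ∧
      ∫ x, (∫ t in Ioo 0 x, g t) ∂P = ∫ t in Ioi 0, g t * P.real (Ioi t) := by
  have hS : MeasurableSet {p : ℝ × ℝ | p.2 < p.1} := measurableSet_lt measurable_snd measurable_fst
  have hslice : ∀ x (f : ℝ → ℝ), ∫ t in Ioi 0, {p : ℝ × ℝ | p.2 < p.1}.indicator
      (fun p => f p.2) (x, t) = ∫ t in Ioo 0 x, f t := by
    intro x f
    have : (fun t => {p : ℝ × ℝ | p.2 < p.1}.indicator (fun p => f p.2) (x, t))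
        = (Iio x).indicator f := by
      ext t; simp [indicator]
    rw [this, setIntegral_indicator measurableSet_Iio, Ioi_inter_Iio]
  have hslice' : ∀ t, ∫ x, {p : ℝ × ℝ | p.2 < p.1}.indicator (fun p => g p.2) (x, t) ∂P
      = g t * P.real (Ioi t) := by
    intro t
    have : (fun x => {p : ℝ × ℝ | p.2 < p.1}.indicator (fun p => g p.2) (x, t))
        = (Ioi t).indicator (fun _ => g t) := by
      ext x; simp [indicator]
    rw [this, integral_indicator_const _ measurableSet_Ioi, smul_eq_mul, mul_comm]
  have hF : Integrable ({p : ℝ × ℝ | p.2 < p.1}.indicator (fun p => g p.2))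
      (P.prod (volume.restrict (Ioi 0))) := by
    have hmeas : Measurable ({p : ℝ × ℝ | p.2 < p.1}.indicator (fun p => g p.2)) :=
      (hg.comp measurable_snd).indicator hS
    rw [integrable_prod_iff hmeas.aestronglyMeasurable]
    constructor
    · refine Filter.Eventually.of_forall fun x => ?_
      have : (fun t => {p : ℝ × ℝ | p.2 < p.1}.indicator (fun p => g p.2) (x, t))
          = (Iio x).indicator g := by
        ext t; simp [indicator]
      rw [this, integrable_indicator_iff measurableSet_Iio, IntegrableOn,
        Measure.restrict_restrict measurableSet_Iio, inter_comm, Ioi_inter_Iio]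
      exact hint x
    · simp_rw [norm_indicator_eq_indicator_norm, Real.norm_eq_abs]
      simpa only [hslice _ (fun t => |g t|)] using hP
  refine ⟨?_, ?_⟩
  · simpa only [hslice', IntegrableOn] using hF.integral_prod_right
  · have := integral_integral_swap (f := fun x t =>
      {p : ℝ × ℝ | p.2 < p.1}.indicator (fun p => g p.2) (x, t)) hF
    simpa only [hslice, hslice'] using this

/-- The tail of a measure on `[0,∞)` with finite mean is integrable, with integral the mean. -/
theorem integral_tail (P : Measure ℝ) [IsFiniteMeasure P] (hP0 : ∀ᵐ x ∂P, 0 ≤ x)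
    (hP : Integrable (fun x => x) P) :
    IntegrableOn (fun t => P.real (Ioi t)) (Ioi 0) ∧
      ∫ t in Ioi 0, P.real (Ioi t) = ∫ x, x ∂P := by
  have hae : (fun x : ℝ => ∫ _ in Ioo 0 x, (1 : ℝ)) =ᵐ[P] fun x => x := by
    filter_upwards [hP0] with x hx
    simp [hx]
  have h := integral_primitive_eq_integral_tail P (g := fun _ => 1) measurable_const
    (fun x => integrableOn_const (by simp)) (by simpa only [abs_one] using hP.congr hae.symm)
  simp only [one_mul] at h
  exact ⟨h.1, by rw [← h.2, integral_congr_ae hae]⟩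

/-- The expected excess over `s` is the integral of the tail over `(s,∞)`. -/
theorem integral_tail_Ioi (P : Measure ℝ) [IsFiniteMeasure P]
    (hP : Integrable (fun x => x) P) {s : ℝ} (hs : 0 ≤ s) :
    ∫ t in Ioi s, P.real (Ioi t) = ∫ x in Ioi s, (x - s) ∂P := by
  have heq : ∀ x : ℝ, ∫ t in Ioo 0 x, (Ioi s).indicator (fun _ => (1 : ℝ)) t =
      (Ioi s).indicator (fun x => x - s) x := by
    intro x
    rw [setIntegral_indicator measurableSet_Ioi, inter_comm, Ioi_inter_Ioo, sup_of_le_left hs]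
    by_cases hx : s < x
    · simp [hx, hx.le]
    · simp [hx]
  have hcont : Integrable (fun x => x - s) P := hP.sub (integrable_const s)
  have h := (integral_primitive_eq_integral_tail P
    (g := (Ioi s).indicator (fun _ => (1 : ℝ))) (measurable_const.indicator measurableSet_Ioi)
    (fun x => (integrableOn_const (by simp)).indicator measurableSet_Ioi) (by
      have : ∀ t, |(Ioi s).indicator (fun _ => (1 : ℝ)) t|
          = (Ioi s).indicator (fun _ => (1 : ℝ)) t := fun t =>
        abs_of_nonneg (indicator_nonneg (fun _ _ => zero_le_one) t)
      simp only [this, heq]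
      exact hcont.indicator measurableSet_Ioi)).2
  simp only [heq] at h
  rw [integral_indicator measurableSet_Ioi] at h
  have hinter : Ioi 0 ∩ Ioi s = Ioi s := by rw [Ioi_inter_Ioi, sup_of_le_right hs]
  rw [h]
  conv_lhs => rw [← hinter]
  rw [← setIntegral_indicator measurableSet_Ioi]
  refine integral_congr_ae (Filter.Eventually.of_forall fun t => ?_)
  by_cases ht : s < t <;> simp [ht]

/-- The first moment of the tail is half the second moment. -/
theorem integral_mul_tail (P : Measure ℝ) [IsFiniteMeasure P] (hP0 : ∀ᵐ x ∂P, 0 ≤ x)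
    (hP : Integrable (fun x => x ^ 2) P) :
    IntegrableOn (fun t => t * P.real (Ioi t)) (Ioi 0) ∧
      ∫ t in Ioi 0, t * P.real (Ioi t) = 1 / 2 * ∫ x, x ^ 2 ∂P := by
  have heq : (fun x : ℝ => ∫ t in Ioo 0 x, t) =ᵐ[P] fun x => 1 / 2 * x ^ 2 := by
    filter_upwards [hP0] with x hx
    rw [← integral_Ioc_eq_integral_Ioo, ← intervalIntegral.integral_of_le hx, integral_id]
    ring
  have habs : (fun x : ℝ => ∫ t in Ioo 0 x, |t|) = fun x : ℝ => ∫ t in Ioo 0 x, t := by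
    ext x
    exact setIntegral_congr_fun measurableSet_Ioo fun t ht => abs_of_pos ht.1
  have h := integral_primitive_eq_integral_tail P (g := fun t => t) measurable_id
    (fun x => (continuous_id.integrableOn_Icc (a := 0) (b := x)).mono_set Ioo_subset_Icc_self)
    (by rw [habs]; exact (hP.const_mul _).congr heq.symm)
  refine ⟨h.1, ?_⟩
  rw [← h.2, integral_congr_ae heq, integral_const_mul]

/-- Expectations of Lipschitz functions in terms of the tail. -/
theorem integral_lipschitz_eq (P : Measure ℝ) [IsProbabilityMeasure P] (hP0 : ∀ᵐ x ∂P, 0 ≤ x)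
    (hP : Integrable (fun x => x) P) {h : ℝ → ℝ} (hh : LipschitzWith 1 h) :
    IntegrableOn (fun t => deriv h t * P.real (Ioi t)) (Ioi 0) ∧
      ∫ x, h x ∂P = h 0 + ∫ t in Ioi 0, deriv h t * P.real (Ioi t) := by
  have hd : ∀ t, |deriv h t| ≤ 1 := fun t => by simpa using norm_deriv_le_of_lipschitz hh
  have hprim : (fun x : ℝ => ∫ t in Ioo 0 x, deriv h t) =ᵐ[P] fun x => h x - h 0 := by
    filter_upwards [hP0] with x hx
    rw [← integral_Ioc_eq_integral_Ioo, ← intervalIntegral.integral_of_le hx]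
    exact (hh.lipschitzOnWith.absolutelyContinuousOnInterval).integral_deriv_eq_sub
  have hint : ∀ x, IntegrableOn (deriv h) (Ioo 0 x) := fun x =>
    Measure.integrableOn_of_bounded (M := 1) (by simp) (measurable_deriv h).aestronglyMeasurable
      (Filter.Eventually.of_forall hd)
  have hhint : Integrable (fun x => h x) P := by
    refine ((integrable_const |h 0|).add hP.abs).mono' hh.continuous.aestronglyMeasurable
      (Filter.Eventually.of_forall fun x => ?_)
    have := hh.dist_le_mul x 0
    simp only [Real.dist_eq, NNReal.coe_one, one_mul, sub_zero] at this
    have h2 := abs_sub_abs_le_abs_sub (h x) (h 0)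
    simp only [Real.norm_eq_abs, Pi.add_apply]
    linarith
  have key := integral_primitive_eq_integral_tail P (measurable_deriv h) hint (by
    have hmeas : Measurable fun x : ℝ => ∫ t in Ioo 0 x, |deriv h t| := by
      have : Monotone fun x : ℝ => ∫ t in Ioo 0 x, |deriv h t| := fun x y hxy =>
        setIntegral_mono_set (hint y).abs (Filter.Eventually.of_forall fun _ => abs_nonneg _)
          (Ioo_subset_Ioo_right hxy).eventuallyLE
      exact this.measurable
    refine hP.mono' hmeas.aestronglyMeasurable ?_
    filter_upwards [hP0] with x hx
    have := norm_setIntegral_le_of_norm_le_const (μ := volume) (s := Ioo 0 x) (C := 1)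
      (f := fun t => |deriv h t|) (by simp) (fun t _ => by simpa using hd t)
    simpa [hx] using this)
  refine ⟨key.1, ?_⟩
  rw [← key.2, integral_congr_ae hprim, integral_sub hhint (integrable_const _)]
  simp

/-- On `[0,∞)` the Wasserstein distance is at most the `L¹` distance between the tails. -/
theorem dW_le_integral_abs_tail_sub (P Q : Measure ℝ) [IsProbabilityMeasure P]
    [IsProbabilityMeasure Q] (hP0 : ∀ᵐ x ∂P, 0 ≤ x) (hQ0 : ∀ᵐ x ∂Q, 0 ≤ x)
    (hP : Integrable (fun x => x) P) (hQ : Integrable (fun x => x) Q) :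
    dW P Q ≤ ∫ t in Ioi 0, |P.real (Ioi t) - Q.real (Ioi t)| := by
  refine Real.iSup_le (fun h => ?_) (integral_nonneg fun _ => abs_nonneg _)
  obtain ⟨hP1, hP2⟩ := integral_lipschitz_eq P hP0 hP h.2
  obtain ⟨hQ1, hQ2⟩ := integral_lipschitz_eq Q hQ0 hQ h.2
  rw [hP2, hQ2, add_sub_add_left_eq_sub, ← integral_sub hP1 hQ1]
  refine (abs_integral_le_integral_abs).trans (integral_mono (hP1.sub hQ1).abs
    ((integral_tail P hP0 hP).1.sub (integral_tail Q hQ0 hQ).1).abs fun t => ?_)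
  have hd : |deriv h.1 t| ≤ 1 := by simpa using norm_deriv_le_of_lipschitz h.2
  simp only [← mul_sub, abs_mul]
  exact mul_le_of_le_one_left (abs_nonneg _) hd

/-- The tail function of a finite measure is antitone. -/
theorem antitone_tail (P : Measure ℝ) [IsFiniteMeasure P] :
    Antitone fun t => P.real (Ioi t) :=
  fun _ _ hst => measureReal_mono (Ioi_subset_Ioi hst)

/-- If `u + ∫ u = K` with `K` monotone and `K 0 = 0`, then `0 ≤ u ≤ K`. -/
theorem nonneg_and_le_of_add_integral_eq {u K : ℝ → ℝ} (hu : Continuous u)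
    (hK : MonotoneOn K (Ici 0)) (hK0 : K 0 = 0)
    (h : ∀ x, 0 ≤ x → u x + ∫ t in (0 : ℝ)..x, u t = K x) {x : ℝ} (hx : 0 ≤ x) :
    0 ≤ u x ∧ u x ≤ K x := by
  have hKx : ∀ y, 0 ≤ y → 0 ≤ K y := fun y hy => hK0 ▸ hK self_mem_Ici hy hy
  have hder : ∀ c y : ℝ, HasDerivAt (fun y => Real.exp y * ((∫ t in (0 : ℝ)..y, u t) - c))
      (Real.exp y * ((∫ t in (0 : ℝ)..y, u t) - c) + Real.exp y * u y) y := fun c y =>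
    (Real.hasDerivAt_exp y).mul ((hu.integral_hasStrictDerivAt 0 y).hasDerivAt.sub_const c)
  have hcont : ∀ c : ℝ, Continuous (fun y => Real.exp y * ((∫ t in (0 : ℝ)..y, u t) - c)) :=
    fun c => continuous_iff_continuousAt.2 fun y => (hder c y).continuousAt
  have hlow : MonotoneOn (fun y => Real.exp y * ((∫ t in (0 : ℝ)..y, u t) - 0)) (Icc 0 x) := by
    refine monotoneOn_of_deriv_nonneg (convex_Icc 0 x) (hcont 0).continuousOn
      (fun y _ => (hder 0 y).differentiableAt.differentiableWithinAt) fun y hy => ?_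
    rw [interior_Icc] at hy
    rw [(hder 0 y).deriv, ← mul_add]
    exact mul_nonneg (Real.exp_pos y).le (by linarith [h y hy.1.le, hKx y hy.1.le])
  have hup : AntitoneOn (fun y => Real.exp y * ((∫ t in (0 : ℝ)..y, u t) - K x)) (Icc 0 x) := by
    refine antitoneOn_of_deriv_nonpos (convex_Icc 0 x) (hcont (K x)).continuousOn
      (fun y _ => (hder (K x) y).differentiableAt.differentiableWithinAt) fun y hy => ?_
    rw [interior_Icc] at hy
    rw [(hder (K x) y).deriv, ← mul_add]
    exact mul_nonpos_of_nonneg_of_nonpos (Real.exp_pos y).le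
      (by linarith [h y hy.1.le, hK hy.1.le hx hy.2.le])
  have h1 := hlow (left_mem_Icc.2 hx) (right_mem_Icc.2 hx) hx
  have h2 := hup (left_mem_Icc.2 hx) (right_mem_Icc.2 hx) hx
  simp only [intervalIntegral.integral_same, sub_zero, mul_zero, zero_sub, mul_neg] at h1 h2
  have h3 := nonneg_of_mul_nonneg_right h1 (Real.exp_pos x)
  have h4 : (∫ t in (0 : ℝ)..x, u t) - K x ≤ 0 := by
    by_contra! hc
    have := mul_pos (Real.exp_pos x) hc
    have := mul_nonneg (Real.exp_pos 0).le (hKx x hx)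
    linarith
  have := h x hx
  constructor <;> linarith

/-- An antitone function that is close to `exp (-x)` in `L¹(0,∞)` is pointwise close to it. -/
theorem sq_abs_sub_exp_le {G : ℝ → ℝ} (hG : Antitone G) (hG1 : ∀ x, G x ≤ 1)
    (hint : IntegrableOn (fun t => |G t - Real.exp (-t)|) (Ioi 0)) {z : ℝ} (hz : 0 ≤ z) :
    |G z - Real.exp (-z)| ^ 2 ≤ 2 * ∫ t in Ioi 0, |G t - Real.exp (-t)| := by
  have hexp : ∀ x y : ℝ, 0 ≤ x → x ≤ y → Real.exp (-x) ≤ Real.exp (-y) + (y - x) := by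
    intro x y hx hxy
    have h1 : Real.exp (-y) = Real.exp (-x) * Real.exp (-(y - x)) := by
      rw [← Real.exp_add]; ring_nf
    have h2 := Real.add_one_le_exp (-(y - x))
    have h3 : Real.exp (-x) ≤ 1 := Real.exp_le_one_iff.2 (by linarith)
    have h4 := Real.exp_pos (-x)
    nlinarith
  have hmain : ∀ a b : ℝ, 0 ≤ a → a ≤ b → ∀ f : ℝ → ℝ, Continuous f →
      (∀ x ∈ Icc a b, f x ≤ |G x - Real.exp (-x)|) →
      ∫ x in a..b, f x ≤ ∫ t in Ioi 0, |G t - Real.exp (-t)| := by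
    intro a b ha hab f hf hle
    have hsub : Ioc a b ⊆ Ioi (0 : ℝ) := fun x hx => ha.trans_lt hx.1
    rw [intervalIntegral.integral_of_le hab]
    refine (setIntegral_mono_on (hf.integrableOn_Icc.mono_set Ioc_subset_Icc_self)
      (hint.mono_set hsub) measurableSet_Ioc fun x hx => hle x ⟨hx.1.le, hx.2⟩).trans ?_
    exact setIntegral_mono_set hint (Filter.Eventually.of_forall fun _ => abs_nonneg _)
      hsub.eventuallyLE
  rcases le_total (Real.exp (-z)) (G z) with hle | hle
  · rw [abs_of_nonneg (sub_nonneg.2 hle)]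
    set d := G z - Real.exp (-z) with hd
    have hd0 : 0 ≤ d := sub_nonneg.2 hle
    have hdz : d ≤ z := by linarith [hG1 z, Real.add_one_le_exp (-z)]
    have := hmain (z - d) z (by linarith) (by linarith) (fun x => d - z + x) (by fun_prop)
      fun x hx => by
        refine le_trans ?_ (le_abs_self _)
        linarith [hG hx.2, hexp x z (by linarith [hx.1]) hx.2]
    rw [intervalIntegral.integral_add (by simp) (by simp), intervalIntegral.integral_const,
      integral_id, smul_eq_mul] at this
    nlinarith
  · rw [abs_of_nonpos (sub_nonpos.2 hle), neg_sub]
    set d := Real.exp (-z) - G z with hd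
    have hd0 : 0 ≤ d := sub_nonneg.2 hle
    have := hmain z (z + d) hz (by linarith) (fun x => d + z - x) (by fun_prop)
      fun x hx => by
        refine le_trans ?_ (neg_le_abs _)
        linarith [hG hx.1, hexp z x hz hx.1]
    rw [intervalIntegral.integral_sub (by simp) (by simp), intervalIntegral.integral_const,
      integral_id, smul_eq_mul] at this
    nlinarith

theorem expMeasure_one_real_Ioi {t : ℝ} (ht : 0 ≤ t) :
    (expMeasure 1).real (Ioi t) = Real.exp (-t) := by
  have := isProbabilityMeasure_expMeasure one_pos
  have h := cdf_expMeasure_eq one_pos t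
  rw [cdf_eq_real, if_pos ht, one_mul] at h
  rw [← compl_Iic, probReal_compl_eq_one_sub measurableSet_Iic, h]
  ring

theorem ae_nonneg_expMeasure_one : ∀ᵐ x ∂expMeasure 1, 0 ≤ x := by
  have : expMeasure 1 (Iio 0) = 0 := by
    rw [expMeasure, gammaMeasure, withDensity_apply _ measurableSet_Iio]
    exact lintegral_gammaPDF_of_nonpos le_rfl
  simp only [ae_iff, not_le]
  exact this

theorem integrable_id_expMeasure_one : Integrable (fun x => x) (expMeasure 1) := by
  have := isProbabilityMeasure_expMeasure one_pos
  refine ⟨measurable_id.aestronglyMeasurable, ?_⟩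
  rw [hasFiniteIntegral_iff_ofReal ae_nonneg_expMeasure_one,
    lintegral_eq_lintegral_meas_lt _ ae_nonneg_expMeasure_one measurable_id.aemeasurable]
  have h : ∀ t ∈ Ioi (0 : ℝ), expMeasure 1 {a | t < a} = ENNReal.ofReal (Real.exp (-t)) := by
    intro t ht
    rw [← expMeasure_one_real_Ioi (le_of_lt ht), ofReal_measureReal]
    rfl
  rw [setLIntegral_congr_fun measurableSet_Ioi h]
  exact (integrableOn_exp_neg_Ioi 0).lintegral_lt_top

/-- On `[0,∞)` the Kolmogorov distance to `Exp(1)` is controlled by the tails. -/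
theorem dK_expMeasure_one_le (P : Measure ℝ) [IsProbabilityMeasure P] (hP0 : ∀ᵐ x ∂P, 0 ≤ x)
    {c : ℝ} (hc : ∀ z, 0 ≤ z → |P.real (Ioi z) - Real.exp (-z)| ≤ c) :
    dK P (expMeasure 1) ≤ c := by
  have := isProbabilityMeasure_expMeasure one_pos
  have hc0 : 0 ≤ c := (abs_nonneg _).trans (hc 0 le_rfl)
  have hIic : ∀ (Q : Measure ℝ) [IsProbabilityMeasure Q] (z : ℝ),
      (Q (Iic z)).toReal = 1 - Q.real (Ioi z) := by
    intro Q _ z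
    rw [← compl_Iic, probReal_compl_eq_one_sub measurableSet_Iic, Measure.real]
    ring
  refine Real.iSup_le (fun z => ?_) hc0
  rcases le_or_gt 0 z with hz | hz
  · rw [hIic P, hIic (expMeasure 1), expMeasure_one_real_Ioi hz, sub_sub_sub_cancel_left,
      abs_sub_comm]
    exact hc z hz
  · have hnull : ∀ Q : Measure ℝ, (∀ᵐ x ∂Q, 0 ≤ x) → Q (Iic z) = 0 := fun Q hQ =>
      measure_mono_null (fun x hx => not_le.2 (lt_of_le_of_lt hx hz)) (ae_iff.1 hQ)
    rw [hnull P hP0, hnull _ ae_nonneg_expMeasure_one]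
    simpa using hc0

/-- Tails and mean of the equilibrium distribution of a mean-one measure on `[0,∞)`. -/
theorem equilibrium_tail_and_mean (P : Measure ℝ) [IsProbabilityMeasure P] (hP0 : ∀ᵐ x ∂P, 0 ≤ x)
    (hP2 : Integrable (fun x => x ^ 2) P) {Q : Measure ℝ}
    (hQ : Q = (volume.restrict (Ioi 0)).withDensity (fun x => P (Ioi x))) :
    (∀ᵐ x ∂Q, 0 ≤ x) ∧ (∀ t, 0 ≤ t → Q.real (Ioi t) = ∫ x in Ioi t, P.real (Ioi x)) ∧
      Integrable (fun x => x) Q ∧ ∫ x, x ∂Q = 1 / 2 * ∫ x, x ^ 2 ∂P := by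
  have hanti : Antitone fun x => P (Ioi x) := fun _ _ h => measure_mono (Ioi_subset_Ioi h)
  have hfin : ∀ (ν : Measure ℝ), ∀ᵐ x ∂ν, P (Ioi x) < ⊤ := fun ν =>
    Filter.Eventually.of_forall fun _ => measure_lt_top _ _
  have hmul := integral_mul_tail P hP0 hP2
  refine ⟨?_, fun t ht => ?_, ?_, ?_⟩
  · rw [hQ]
    refine (withDensity_absolutelyContinuous _ _).ae_le ?_
    filter_upwards [ae_restrict_mem measurableSet_Ioi] with x hx using le_of_lt hx
  · rw [hQ, Measure.real, withDensity_apply _ measurableSet_Ioi,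
      Measure.restrict_restrict measurableSet_Ioi, Ioi_inter_Ioi, sup_of_le_left ht]
    exact (integral_toReal hanti.measurable.aemeasurable (hfin _)).symm
  · rw [hQ, integrable_withDensity_iff_integrable_smul' hanti.measurable (hfin _)]
    simpa only [smul_eq_mul, mul_comm, Measure.real, IntegrableOn] using hmul.1
  · rw [hQ, integral_withDensity_eq_integral_toReal_smul hanti.measurable (hfin _), ← hmul.2]
    simp only [smul_eq_mul, mul_comm, Measure.real]

/-- If `H` is the integrated tail of `G` and `H - G` has constant sign `σ` on `(0,∞)`, then
`H x - exp (-x)` has the same sign and is dominated by the integral of `H - G`. -/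
theorem integrated_tail_sub_exp_bounds {G H : ℝ → ℝ}
    (hG : ∀ a b, IntervalIntegrable G volume a b) (hG0 : IntegrableOn G (Ioi 0))
    (hH0 : IntegrableOn H (Ioi 0)) (hG1 : ∫ t in Ioi 0, G t = 1)
    (hH : ∀ x, 0 ≤ x → H x = ∫ t in Ioi x, G t) {σ : ℝ}
    (hσ : ∀ s, 0 < s → 0 ≤ σ * (H s - G s)) {x : ℝ} (hx : 0 ≤ x) :
    0 ≤ σ * (H x - Real.exp (-x)) ∧
      σ * (H x - Real.exp (-x)) ≤ σ * ((∫ t in Ioi 0, H t) - 1) := by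
  have hHeq : ∀ y, 0 ≤ y → H y = 1 - ∫ t in (0 : ℝ)..y, G t := by
    intro y hy
    rw [hH y hy, ← hG1, ← intervalIntegral.integral_interval_add_Ioi hG0
      (hG0.mono_set (Ioi_subset_Ioi hy))]
    ring
  have hD : IntegrableOn (fun t => σ * (H t - G t)) (Ioi 0) := (hH0.sub hG0).const_mul σ
  have hDnn : 0 ≤ᵐ[volume.restrict (Ioi 0)] fun t => σ * (H t - G t) := by
    filter_upwards [ae_restrict_mem measurableSet_Ioi] with t ht using hσ t ht
  have hucont : Continuous fun y => σ * ((1 - ∫ t in (0 : ℝ)..y, G t) - Real.exp (-y)) := by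
    have := intervalIntegral.continuous_primitive hG 0
    fun_prop
  have hu : ∀ y, 0 ≤ y → σ * ((1 - ∫ t in (0 : ℝ)..y, G t) - Real.exp (-y)) +
      ∫ z in (0 : ℝ)..y, σ * ((1 - ∫ t in (0 : ℝ)..z, G t) - Real.exp (-z)) =
      ∫ t in Ioc 0 y, σ * (H t - G t) := by
    intro y hy
    have hHy : IntervalIntegrable H volume 0 y :=
      (intervalIntegrable_iff_integrableOn_Ioc_of_le hy).2 (hH0.mono_set Ioc_subset_Ioi_self)
    have hE : IntervalIntegrable (fun z => Real.exp (-z)) volume 0 y :=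
      Continuous.intervalIntegrable (by fun_prop) _ _
    have hcongr : ∫ z in (0 : ℝ)..y, σ * ((1 - ∫ t in (0 : ℝ)..z, G t) - Real.exp (-z)) =
        ∫ z in (0 : ℝ)..y, σ * (H z - Real.exp (-z)) := by
      refine intervalIntegral.integral_congr fun z hz => ?_
      rw [uIcc_of_le hy] at hz
      simp only [hHeq z hz.1]
    have hexp : ∫ z in (0 : ℝ)..y, Real.exp (-z) = 1 - Real.exp (-y) := by simp
    rw [hcongr, ← intervalIntegral.integral_of_le hy, intervalIntegral.integral_const_mul,
      intervalIntegral.integral_const_mul, intervalIntegral.integral_sub hHy hE,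
      intervalIntegral.integral_sub hHy (hG 0 y), hexp]
    ring
  have hK : MonotoneOn (fun y => ∫ t in Ioc 0 y, σ * (H t - G t)) (Ici 0) := fun a _ b _ hab =>
    setIntegral_mono_set (hD.mono_set Ioc_subset_Ioi_self)
      (ae_restrict_of_ae_restrict_of_subset Ioc_subset_Ioi_self hDnn)
      (Ioc_subset_Ioc_right hab).eventuallyLE
  obtain ⟨h1, h2⟩ := nonneg_and_le_of_add_integral_eq hucont hK (by simp) hu hx
  rw [hHeq x hx]
  refine ⟨h1, h2.trans ?_⟩
  rw [← hG1, ← integral_sub hH0 hG0, ← integral_const_mul]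
  exact setIntegral_mono_set hD hDnn Ioc_subset_Ioi_self.eventuallyLE

/-- Distance bounds to `Exp(1)` for a mean-one measure `P` on `[0,∞)` and its equilibrium
distribution `Q`, when the difference of their tails has a constant sign `σ = ±1`. -/
theorem distance_bounds_of_tail_sign (P Q : Measure ℝ) [IsProbabilityMeasure P]
    [IsProbabilityMeasure Q] (hP0 : ∀ᵐ x ∂P, 0 ≤ x) (hP : Integrable (fun x => x) P)
    (hP1 : ∫ x, x ∂P = 1) (hP2 : Integrable (fun x => x ^ 2) P)
    (hQ : Q = (volume.restrict (Ioi 0)).withDensity (fun x => P (Ioi x)))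
    {σ : ℝ} (hσ1 : |σ| = 1) (hσ : ∀ s, 0 < s → 0 ≤ σ * (Q.real (Ioi s) - P.real (Ioi s)))
    {ρ : ℝ} (hρ : ρ = |1 / 2 * (∫ x, x ^ 2 ∂P) - 1|) :
    dW P (expMeasure 1) ≤ 2 * ρ ∧ dK P (expMeasure 1) ≤ 2 * Real.sqrt ρ ∧
      dW Q (expMeasure 1) ≤ ρ ∧ dK Q (expMeasure 1) ≤ ρ := by
  have := isProbabilityMeasure_expMeasure one_pos
  obtain ⟨hQ0, hQtail, hQint, hQmean⟩ := equilibrium_tail_and_mean P hP0 hP2 hQ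
  obtain ⟨hG0, hG1⟩ := integral_tail P hP0 hP
  obtain ⟨hH0, hH1⟩ := integral_tail Q hQ0 hQint
  rw [hP1] at hG1
  rw [hQmean] at hH1
  have hE0 := integrableOn_exp_neg_Ioi 0
  have hb := fun (x : ℝ) (hx : 0 ≤ x) => integrated_tail_sub_exp_bounds
    (fun a b => (antitone_tail P).intervalIntegrable) hG0 hH0 hG1 hQtail hσ hx
  rw [hH1] at hb
  have habs : ∀ a, 0 ≤ σ * a → |a| = σ * a := fun a ha => by
    rw [← abs_of_nonneg ha, abs_mul, hσ1, one_mul]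
  have hρσ : ρ = σ * (1 / 2 * (∫ x, x ^ 2 ∂P) - 1) := by
    rw [hρ, habs _ ((hb 0 le_rfl).1.trans (hb 0 le_rfl).2)]
  have hHE : ∫ t in Ioi 0, |Q.real (Ioi t) - Real.exp (-t)| = ρ := by
    rw [setIntegral_congr_fun measurableSet_Ioi fun t ht => habs _ (hb t (le_of_lt ht)).1,
      integral_const_mul, integral_sub hH0 hE0, hH1, integral_exp_neg_Ioi_zero, hρσ]
  have hGH : ∫ t in Ioi 0, |Q.real (Ioi t) - P.real (Ioi t)| = ρ := by
    rw [setIntegral_congr_fun measurableSet_Ioi fun t ht => habs _ (hσ t ht),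
      integral_const_mul, integral_sub hH0 hG0, hH1, hG1, hρσ]
  have hGE : ∫ t in Ioi 0, |P.real (Ioi t) - Real.exp (-t)| ≤ 2 * ρ := by
    calc ∫ t in Ioi 0, |P.real (Ioi t) - Real.exp (-t)|
        ≤ ∫ t in Ioi 0, (|Q.real (Ioi t) - P.real (Ioi t)| +
            |Q.real (Ioi t) - Real.exp (-t)|) :=
          integral_mono (hG0.sub hE0).abs ((hH0.sub hG0).abs.add (hH0.sub hE0).abs) fun t =>
            (abs_sub_le _ (Q.real (Ioi t)) _).trans_eq (by rw [abs_sub_comm])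
      _ = 2 * ρ := by
          rw [two_mul]
          exact (integral_add (hH0.sub hG0).abs (hH0.sub hE0).abs).trans
            (congrArg₂ (· + ·) hGH hHE)
  have hW : ∀ (ν : Measure ℝ) [IsProbabilityMeasure ν], (∀ᵐ x ∂ν, 0 ≤ x) →
      Integrable (fun x => x) ν →
      dW ν (expMeasure 1) ≤ ∫ t in Ioi 0, |ν.real (Ioi t) - Real.exp (-t)| := by
    intro ν _ hν0 hν
    refine (dW_le_integral_abs_tail_sub ν _ hν0 ae_nonneg_expMeasure_one hν
      integrable_id_expMeasure_one).trans_eq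
        (setIntegral_congr_fun measurableSet_Ioi fun t ht => ?_)
    simp only [expMeasure_one_real_Ioi (le_of_lt ht)]
  refine ⟨(hW P hP0 hP).trans hGE, dK_expMeasure_one_le P hP0 fun z hz => ?_,
    (hW Q hQ0 hQint).trans hHE.le, dK_expMeasure_one_le Q hQ0 fun z hz => ?_⟩
  · have h := (sq_abs_sub_exp_le (antitone_tail P) (fun _ => measureReal_le_one)
      (hG0.sub hE0).abs hz).trans (mul_le_mul_of_nonneg_left hGE zero_le_two)
    have hρ0 : 0 ≤ ρ := hρ ▸ abs_nonneg _
    refine (sq_le_sq₀ (abs_nonneg _) (by positivity)).1 ?_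
    rw [mul_pow, Real.sq_sqrt hρ0]
    linarith
  · rw [habs _ (hb z hz).1, hρσ]
    exact (hb z hz).2

/-- The tail excess of `X` over `s` as an unnormalized conditional expectation. -/
theorem integral_cond_sub_mul {Ω : Type*} [MeasurableSpace Ω] (μ : Measure Ω)
    [IsProbabilityMeasure μ] {X : Ω → ℝ} (hX : Measurable X) (s : ℝ) :
    ∫ ω, (X ω - s) ∂(μ[|{ω | s < X ω}]) =
      ((Measure.map X μ).real (Ioi s))⁻¹ * ∫ x in Ioi s, (x - s) ∂(Measure.map X μ) := by
  rw [setIntegral_map measurableSet_Ioi (by fun_prop) hX.aemeasurable, ProbabilityTheory.cond,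
    integral_smul_measure, map_measureReal_apply hX measurableSet_Ioi, ENNReal.toReal_inv]
  rfl

theorem exponential_bounds_NBUE_NWUE
    {Ω : Type*} [MeasurableSpace Ω] (μ : Measure Ω) [IsProbabilityMeasure μ]
    (W We : Ω → ℝ) (hWmeas : Measurable W) (hWemeas : Measurable We)
    (hWnonneg : ∀ ω, 0 ≤ W ω) (hWint : Integrable W μ)
    (hW2 : Integrable (fun ω => (W ω) ^ 2) μ)
    (hEW : ∫ ω, W ω ∂μ = 1)
    (hage : NBUE μ W ∨ NWUE μ W)
    (hWe : IsEquilibrium μ W We)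
    (ρ : ℝ) (hρ : ρ = |(1 / 2 : ℝ) * (∫ ω, (W ω) ^ 2 ∂μ) - 1|) :
    dW (Measure.map W μ) (expMeasure 1) ≤ 2 * ρ ∧
    dK (Measure.map W μ) (expMeasure 1) ≤ 2.47 * Real.sqrt ρ ∧
    dW (Measure.map We μ) (expMeasure 1) ≤ ρ ∧
    dK (Measure.map We μ) (expMeasure 1) ≤ ρ := by
  have := Measure.isProbabilityMeasure_map (μ := μ) hWmeas.aemeasurable
  have := Measure.isProbabilityMeasure_map (μ := μ) hWemeas.aemeasurable
  set P := Measure.map W μ with hPdef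
  have hP0 : ∀ᵐ x ∂P, 0 ≤ x :=
    (ae_map_iff hWmeas.aemeasurable measurableSet_Ici).2 (Filter.Eventually.of_forall hWnonneg)
  have hP : Integrable (fun x => x) P :=
    (integrable_map_measure measurable_id.aestronglyMeasurable hWmeas.aemeasurable).2 hWint
  have hP2 : Integrable (fun x => x ^ 2) P :=
    (integrable_map_measure (by fun_prop) hWmeas.aemeasurable).2 hW2
  have hP1 : ∫ x, x ∂P = 1 := by
    rw [hPdef, integral_map hWmeas.aemeasurable (by fun_prop), hEW]
  have hsq : ∫ x, x ^ 2 ∂P = ∫ ω, (W ω) ^ 2 ∂μ :=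
    integral_map hWmeas.aemeasurable (by fun_prop)
  have hPIoi : ∀ x, P (Ioi x) = μ {ω | x < W ω} := fun x =>
    Measure.map_apply hWmeas measurableSet_Ioi
  have hQ : Measure.map We μ = (volume.restrict (Ioi 0)).withDensity (fun x => P (Ioi x)) := by
    rw [hWe, restrict_Ioi_eq_restrict_Ici, ← withDensity_indicator measurableSet_Ici]
    congr 1
    ext x
    simp only [indicator, mem_Ici, hEW, ENNReal.ofReal_one, div_one, hPIoi]
  have htail := (equilibrium_tail_and_mean P hP0 hP2 hQ).2.1
  have hnull : ∀ s, 0 < s → P.real (Ioi s) = 0 → (Measure.map We μ).real (Ioi s) = 0 := by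
    intro s hs h
    rw [htail s hs.le, integral_tail_Ioi P hP hs.le]
    exact setIntegral_measure_zero _ ((measureReal_eq_zero_iff).1 h)
  have hexcess : ∀ s, 0 < s → ∫ ω, (W ω - s) ∂(μ[|{ω | s < W ω}]) =
      (P.real (Ioi s))⁻¹ * (Measure.map We μ).real (Ioi s) := fun s hs => by
    rw [integral_cond_sub_mul μ hWmeas, htail s hs.le, integral_tail_Ioi P hP hs.le]
  have hne : ∀ s, P.real (Ioi s) ≠ 0 → μ {ω | s < W ω} ≠ 0 := fun s h h0 =>
    h (by rw [Measure.real, hPIoi, h0, ENNReal.toReal_zero])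
  obtain ⟨σ, hσ1, hσ⟩ : ∃ σ : ℝ, |σ| = 1 ∧ ∀ s, 0 < s →
      0 ≤ σ * ((Measure.map We μ).real (Ioi s) - P.real (Ioi s)) := by
    rcases hage with h | h
    · refine ⟨-1, by simp, fun s hs => ?_⟩
      by_cases h0 : P.real (Ioi s) = 0
      · simp [h0, hnull s hs h0]
      · have hpos := measureReal_nonneg.lt_of_ne' h0
        have := h s hs (hne s h0)
        rw [hexcess s hs, hEW, inv_mul_le_iff₀ hpos] at this
        linarith
    · refine ⟨1, by simp, fun s hs => ?_⟩
      by_cases h0 : P.real (Ioi s) = 0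
      · simp [h0, hnull s hs h0]
      · have hpos := measureReal_nonneg.lt_of_ne' h0
        have := h s hs (hne s h0)
        rw [hexcess s hs, hEW, le_inv_mul_iff₀ hpos] at this
        linarith
  rw [← hsq] at hρ
  obtain ⟨h1, h2, h3⟩ := distance_bounds_of_tail_sign P _ hP0 hP hP1 hP2 hQ hσ1 hσ hρ
  exact ⟨h1, h2.trans (mul_le_mul_of_nonneg_right (by norm_num) (Real.sqrt_nonneg _)), h3⟩

end
end
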